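/- Let M, L, K ≥ 0 and a ∈ (0,1/2). Let F̄ : H → H satisfy ‖F̄(z)‖ ≤ M and ‖F̄(z₁) − F̄(z₂)‖ ≤ L‖z₁−z₂‖ for all z, z₁, z₂. Let 𝓛 : H → L(H) be an operator-valued map with ‖𝓛(z)‖ ≤ K for all z, and such that ‖(𝓛(z₁) − 𝓛(z₂))(k)‖ ≤ K ‖z₁ − z₂‖ · |k|_a for all z₁, z₂ ∈ H and k ∈ D_a. Let x, h ∈ H, let X̄ : [0,∞) → H be continuous with X̄(t) = S(t)x + ∫₀^t S(t−s) F̄(X̄(s)) ds, and let η : [0,∞) → H be continuous, with s ↦ 𝓛(X̄(s))(η(s)) continuous, satisfying η(t) = S(t)h + ∫₀^t S(t−s) 𝓛(X̄(s))(η(s)) ds. Then for every T > 0 there exists a constant C (depending only on T, a, M, L, K and λ₀) such that for all t ∈ (0,T], η(t) ∈ D_1 and |η(t)|_1 ≤ C (1 + t^{-1}) (1 + ‖x‖) ‖h‖. -/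

import Mathlib

open Real MeasureTheory Set Filter
open scoped ENNReal Topology

noncomputable section

/-- `Hsp` is the real Hilbert space `ℓ²` of square-summable real sequences. -/
abbrev Hsp : Type := lp (fun _ : ℕ => ℝ) 2

/-- The norm `|x|_σ = (∑ₖ λₖ^{2σ} xₖ²)^{1/2}` of the domain `D((-A)^σ)`;
in particular `|x|_1 = ‖Ax‖`. -/
noncomputable def nrmD (lam : ℕ → ℝ) (σ : ℝ) (x : Hsp) : ℝ :=
  Real.sqrt (∑' k, lam k ^ (2 * σ) * (x k) ^ 2)

/-- Membership in the domain `D((-A)^σ)`: `∑ₖ λₖ^{2σ} xₖ² < ∞`. -/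
def memD (lam : ℕ → ℝ) (σ : ℝ) (x : Hsp) : Prop :=
  Summable (fun k => lam k ^ (2 * σ) * (x k) ^ 2)

theorem hasSum_coord_sq (x : Hsp) : HasSum (fun k => (x k) ^ 2) (‖x‖ ^ 2) := by
  have h := lp.hasSum_norm (p := 2) (by norm_num) x
  simpa using h

theorem norm_le_of_abs_coord_le {x y : Hsp} {c : ℝ} (hc : 0 ≤ c)
    (h : ∀ k, |y k| ≤ c * |x k|) : ‖y‖ ≤ c * ‖x‖ := by
  have : ‖y‖ ≤ ‖c • x‖ := by
    refine lp.norm_mono (by norm_num) fun k => ?_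
    simpa [abs_mul, abs_of_nonneg hc] using h k
  simpa [norm_smul, abs_of_nonneg hc] using this

/-- The bounded diagonal operator on `ℓ²` with the multiplier sequence `m`. -/
def diagOp (m : ℕ → ℝ) {c : ℝ} (hc : 0 ≤ c) (hm : ∀ k, |m k| ≤ c) : Hsp →L[ℝ] Hsp :=
  lp.mapCLM (𝕜 := ℝ) 2 (fun k => m k • ContinuousLinearMap.id ℝ ℝ) hc (fun k => by
    simpa [norm_smul] using hm k)

@[simp] theorem diagOp_apply (m : ℕ → ℝ) {c : ℝ} (hc : 0 ≤ c) (hm : ∀ k, |m k| ≤ c)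
    (x : Hsp) (k : ℕ) : diagOp m hc hm x k = m k * x k := by
  simp [diagOp]

/-- The diagonal semigroup `e^{tA}`, extended by the identity to negative times. -/
def heat {lam : ℕ → ℝ} (hl : ∀ k, 0 ≤ lam k) (t : ℝ) : Hsp →L[ℝ] Hsp :=
  diagOp (fun k => Real.exp (-(lam k * max t 0))) zero_le_one (fun k => by
    rw [abs_of_pos (Real.exp_pos _), Real.exp_le_one_iff]
    have := mul_nonneg (hl k) (le_max_right t 0)
    linarith)

/-- The fractional power `(-A)^σ`, truncated to the first `n` coordinates. -/
def truncPow {lam : ℕ → ℝ} (hl : ∀ k, 0 ≤ lam k) (σ : ℝ) (n : ℕ) : Hsp →L[ℝ] Hsp :=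
  diagOp (fun k => if k < n then lam k ^ σ else 0)
    (Finset.sum_nonneg fun k (_ : k ∈ Finset.range n) => Real.rpow_nonneg (hl k) σ)
    (fun k => by
      split_ifs with hk
      · rw [abs_of_nonneg (Real.rpow_nonneg (hl k) σ)]
        exact Finset.single_le_sum (f := fun k => lam k ^ σ)
          (fun i _ => Real.rpow_nonneg (hl i) σ) (Finset.mem_range.2 hk)
      · simpa using Finset.sum_nonneg
          fun k (_ : k ∈ Finset.range n) => Real.rpow_nonneg (hl k) σ)

section Semigroup

variable {lam : ℕ → ℝ} (hl : ∀ k, 0 ≤ lam k)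

theorem heat_apply {t : ℝ} (ht : 0 ≤ t) (x : Hsp) (k : ℕ) :
    heat hl t x k = Real.exp (-(lam k * t)) * x k := by
  simp [heat, max_eq_left ht]

theorem truncPow_apply (σ : ℝ) (n : ℕ) (x : Hsp) (k : ℕ) :
    truncPow hl σ n x k = (if k < n then lam k ^ σ else 0) * x k := by
  simp only [truncPow, diagOp_apply]

theorem norm_heat_apply_le (t : ℝ) (x : Hsp) : ‖heat hl t x‖ ≤ ‖x‖ := by
  rw [← one_mul ‖x‖]
  refine norm_le_of_abs_coord_le zero_le_one fun k => ?_
  rw [heat, diagOp_apply, abs_mul, abs_of_pos (Real.exp_pos _)]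
  gcongr
  rw [Real.exp_le_one_iff]
  have := mul_nonneg (hl k) (le_max_right t 0)
  linarith

theorem heat_add {s t : ℝ} (hs : 0 ≤ s) (ht : 0 ≤ t) (x : Hsp) :
    heat hl (s + t) x = heat hl s (heat hl t x) := by
  ext k
  rw [heat_apply hl (add_nonneg hs ht), heat_apply hl hs, heat_apply hl ht, ← mul_assoc,
    ← Real.exp_add]
  ring_nf

theorem continuous_heat_apply (x : Hsp) : Continuous fun t => heat hl t x := by
  have hsq (s t : ℝ) : ‖heat hl t x - heat hl s x‖ ^ 2 =
      ∑' k, ((Real.exp (-(lam k * max t 0)) - Real.exp (-(lam k * max s 0))) * x k) ^ 2 := by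
    rw [← (hasSum_coord_sq _).tsum_eq]
    congr 1
    ext k
    simp only [lp.coeFn_sub, Pi.sub_apply, heat, diagOp_apply]
    ring
  have hle (k : ℕ) (t : ℝ) : Real.exp (-(lam k * max t 0)) ≤ 1 := by
    rw [Real.exp_le_one_iff]
    have := mul_nonneg (hl k) (le_max_right t 0)
    linarith
  rw [continuous_iff_continuousAt]
  intro s
  have hc : Continuous fun t => ‖heat hl t x - heat hl s x‖ ^ 2 := by
    simp_rw [hsq s]
    refine continuous_tsum (fun k => by fun_prop) (hasSum_coord_sq x).summable fun k t => ?_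
    rw [Real.norm_eq_abs, abs_of_nonneg (sq_nonneg _), mul_pow]
    refine mul_le_of_le_one_left (sq_nonneg _) ?_
    have h1 := hle k t
    have h2 := hle k s
    have h3 := Real.exp_pos (-(lam k * max t 0))
    have h4 := Real.exp_pos (-(lam k * max s 0))
    nlinarith
  have h0 := (Real.continuous_sqrt.comp hc).tendsto s
  simp only [Function.comp_def, Real.sqrt_sq (norm_nonneg _), sub_self, norm_zero] at h0
  rw [zero_pow two_ne_zero, Real.sqrt_zero] at h0
  exact tendsto_iff_norm_sub_tendsto_zero.2 h0

theorem continuous_heat : Continuous fun p : Hsp × ℝ => heat hl p.2 p.1 := by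
  refine continuous_prod_of_continuous_lipschitzWith _ 1 (continuous_heat_apply hl) fun t => ?_
  refine LipschitzWith.of_dist_le_mul fun x y => ?_
  simp only [dist_eq_norm, ← map_sub, NNReal.coe_one, one_mul]
  exact norm_heat_apply_le hl t _

theorem intervalIntegrable_heat {f : ℝ → Hsp} (hf : ContinuousOn f (Set.Ici 0)) {a b : ℝ} (t : ℝ)
    (ha : 0 ≤ a) (hb : 0 ≤ b) :
    IntervalIntegrable (fun s => heat hl (t - s) (f s)) volume a b := by
  refine ContinuousOn.intervalIntegrable ?_
  have hsub : Set.uIcc a b ⊆ Set.Ici 0 := fun s hs => (le_min ha hb).trans hs.1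
  have hp : ContinuousOn (fun s => (f s, t - s)) (Set.uIcc a b) :=
    (hf.mono hsub).prodMk (continuous_const.sub continuous_id).continuousOn
  intro s hs
  have h := ((continuous_heat hl).tendsto (f s, t - s)).comp (hp s hs)
  exact h

/-- `u ^ σ e^{-u} ≤ 1` summed over coordinates: the smoothing effect of the semigroup. -/
theorem norm_truncPow_heat_le {σ : ℝ} (hσ : 0 ≤ σ) (hσ1 : σ ≤ 1) (n : ℕ) {t : ℝ} (ht : 0 < t)
    (x : Hsp) : ‖truncPow hl σ n (heat hl t x)‖ ≤ t ^ (-σ) * ‖x‖ := by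
  refine norm_le_of_abs_coord_le (Real.rpow_nonneg ht.le _) fun k => ?_
  rw [truncPow_apply, heat_apply hl ht.le, ← mul_assoc, abs_mul]
  gcongr
  split_ifs
  · rw [abs_of_nonneg (mul_nonneg (Real.rpow_nonneg (hl k) _) (Real.exp_pos _).le),
      Real.rpow_neg ht.le, Real.exp_neg, ← div_eq_mul_inv, div_le_iff₀ (Real.exp_pos _),
      ← div_eq_inv_mul, le_div_iff₀ (Real.rpow_pos_of_pos ht _), ← Real.mul_rpow (hl k) ht.le]
    have hu : 0 ≤ lam k * t := mul_nonneg (hl k) ht.le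
    refine le_trans ?_ (Real.add_one_le_exp _)
    rcases le_total (lam k * t) 1 with h | h
    · linarith [Real.rpow_le_one hu h hσ]
    · have := Real.rpow_le_rpow_of_exponent_le h hσ1
      rw [Real.rpow_one] at this
      linarith
  · simpa using Real.rpow_nonneg ht.le _

theorem memD_and_nrmD_le_of_truncPow {σ : ℝ} {x : Hsp} {B : ℝ}
    (h : ∀ n, ‖truncPow hl σ n x‖ ≤ B) : memD lam σ x ∧ nrmD lam σ x ≤ B := by
  have hB : 0 ≤ B := (norm_nonneg _).trans (h 0)
  have hnn (k : ℕ) : 0 ≤ lam k ^ (2 * σ) * (x k) ^ 2 :=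
    mul_nonneg (Real.rpow_nonneg (hl k) _) (sq_nonneg _)
  have hs (n : ℕ) : ∑ k ∈ Finset.range n, lam k ^ (2 * σ) * (x k) ^ 2 ≤ B ^ 2 := by
    calc ∑ k ∈ Finset.range n, lam k ^ (2 * σ) * (x k) ^ 2
        = ∑ k ∈ Finset.range n, (truncPow hl σ n x k) ^ 2 := by
          refine Finset.sum_congr rfl fun k hk => ?_
          rw [truncPow_apply, if_pos (Finset.mem_range.1 hk), mul_pow, mul_comm 2 σ,
            Real.rpow_mul (hl k), Real.rpow_two]
      _ ≤ ‖truncPow hl σ n x‖ ^ 2 :=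
          sum_le_hasSum _ (fun k _ => sq_nonneg _) (hasSum_coord_sq _)
      _ ≤ B ^ 2 := by gcongr; exact h n
  refine ⟨summable_of_sum_range_le hnn hs, ?_⟩
  rw [nrmD]
  exact Real.sqrt_le_iff.2 ⟨hB, Real.tsum_le_of_sum_range_le hnn hs⟩

theorem norm_heat_sub_le {t : ℝ} (ht : 0 ≤ t) {x : Hsp} (hx : memD lam (1 / 2) x) :
    ‖heat hl t x - x‖ ≤ √t * nrmD lam (1 / 2) x := by
  rw [nrmD, ← Real.sqrt_mul ht]
  refine Real.le_sqrt_of_sq_le ?_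
  rw [← (hasSum_coord_sq _).tsum_eq, ← tsum_mul_left]
  refine (hasSum_coord_sq _).summable.tsum_le_tsum (fun k => ?_) (hx.mul_left t)
  simp only [lp.coeFn_sub, Pi.sub_apply]
  rw [heat_apply hl ht]
  have hu : 0 ≤ lam k * t := mul_nonneg (hl k) ht
  have h1 := Real.one_sub_le_exp_neg (lam k * t)
  have h2 : Real.exp (-(lam k * t)) ≤ 1 := by rw [Real.exp_le_one_iff]; linarith
  have h3 := Real.exp_pos (-(lam k * t))
  rw [show (2 : ℝ) * (1 / 2) = 1 by norm_num, Real.rpow_one, ← mul_assoc,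
    show Real.exp (-(lam k * t)) * x k - x k = (1 - Real.exp (-(lam k * t))) * -x k by ring,
    mul_pow, neg_sq]
  gcongr
  nlinarith

theorem memD_and_nrmD_le_of_le {lam0 : ℝ} (h0 : 0 < lam0) (hlam : ∀ k, lam0 ≤ lam k) {σ τ : ℝ}
    (hστ : σ ≤ τ) {x : Hsp} (hx : memD lam τ x) :
    memD lam σ x ∧ nrmD lam σ x ≤ lam0 ^ (σ - τ) * nrmD lam τ x := by
  have hle (k : ℕ) : lam k ^ (2 * σ) * (x k) ^ 2 ≤
      (lam0 ^ (σ - τ)) ^ 2 * (lam k ^ (2 * τ) * (x k) ^ 2) := by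
    have hk := h0.trans_le (hlam k)
    rw [← mul_assoc, show 2 * σ = (σ - τ) * (2 : ℕ) + 2 * τ by push_cast; ring,
      Real.rpow_add hk, Real.rpow_mul hk.le, Real.rpow_natCast]
    have : lam k ^ (σ - τ) ≤ lam0 ^ (σ - τ) :=
      Real.rpow_le_rpow_of_nonpos h0 (hlam k) (by linarith)
    have := Real.rpow_nonneg hk.le (σ - τ)
    have := Real.rpow_nonneg hk.le (2 * τ)
    gcongr
  have hs : memD lam σ x := by
    refine Summable.of_nonneg_of_le (fun k => ?_) hle (hx.mul_left _)
    exact mul_nonneg (Real.rpow_nonneg (h0.le.trans (hlam k)) _) (sq_nonneg _)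
  refine ⟨hs, ?_⟩
  rw [nrmD, nrmD, ← Real.sqrt_sq (Real.rpow_nonneg h0.le (σ - τ)),
    ← Real.sqrt_mul (sq_nonneg _), ← tsum_mul_left]
  exact Real.sqrt_le_sqrt (hs.tsum_le_tsum hle (hx.mul_left _))

theorem norm_truncPow_integral_heat_le (n : ℕ) {s t : ℝ} (hs : 0 ≤ s) (hst : s ≤ t) (x : Hsp) :
    ‖truncPow hl 1 n (∫ r in s..t, heat hl (t - r) x)‖ ≤ ‖x‖ := by
  have hi := intervalIntegrable_heat hl (continuousOn_const (c := x)) t hs (hs.trans hst)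
  rw [← one_mul ‖x‖]
  refine norm_le_of_abs_coord_le zero_le_one fun k => ?_
  have hcoord : lam k * (∫ r in s..t, heat hl (t - r) x) k =
      (1 - Real.exp (-(lam k * (t - s)))) * x k := by
    have h1 : ∫ r in s..t, heat hl (t - r) x k = (∫ r in s..t, heat hl (t - r) x) k :=
      (lp.evalCLM ℝ (fun _ : ℕ => ℝ) 2 k).intervalIntegral_comp_comm hi
    rw [← h1, ← intervalIntegral.integral_const_mul]
    have hd (r : ℝ) : HasDerivAt (fun r => Real.exp (-(lam k * (t - r))) * x k)
        (lam k * (Real.exp (-(lam k * (t - r))) * x k)) r := by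
      have h := ((((hasDerivAt_id r).const_sub t).const_mul (lam k)).neg.exp).mul_const (x k)
      exact h.congr_deriv (by simp; ring)
    rw [intervalIntegral.integral_congr (g := fun r => lam k * (Real.exp (-(lam k * (t - r))) * x k)),
      intervalIntegral.integral_eq_sub_of_hasDerivAt (fun r _ => hd r)]
    · simp; ring
    · exact Continuous.intervalIntegrable (by fun_prop) _ _
    · intro r hr
      rw [Set.uIcc_of_le hst] at hr
      change lam k * heat hl (t - r) x k = _
      rw [heat_apply hl (by linarith [hr.2])]
  rw [truncPow_apply, Real.rpow_one]
  split_ifs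
  · rw [hcoord, abs_mul]
    gcongr
    have hu : 0 ≤ lam k * (t - s) := mul_nonneg (hl k) (by linarith)
    have h2 : Real.exp (-(lam k * (t - s))) ≤ 1 := by rw [Real.exp_le_one_iff]; linarith
    have h3 := Real.exp_pos (-(lam k * (t - s)))
    rw [abs_le]
    constructor <;> linarith
  · simp

end Semigroup

theorem intervalIntegrable_inv_sqrt_sub (s t : ℝ) :
    IntervalIntegrable (fun r => (√(t - r))⁻¹) volume s t := by
  have h := (intervalIntegral.intervalIntegrable_rpow' (a := t - s) (b := 0) (r := -(1 / 2))
    (by norm_num)).comp_sub_left t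
  simp only [sub_sub_cancel, sub_zero] at h
  rcases le_total s t with hst | hst
  · refine h.congr_uIoo fun r hr => ?_
    rw [Set.uIoo_of_le hst] at hr
    change (t - r) ^ (-(1 / 2) : ℝ) = (√(t - r))⁻¹
    rw [Real.sqrt_eq_rpow, Real.rpow_neg (by linarith [hr.2])]
  · refine (intervalIntegrable_const (c := (0 : ℝ))).congr_uIoo fun r hr => ?_
    rw [Set.uIoo_of_ge hst] at hr
    change (0 : ℝ) = (√(t - r))⁻¹
    rw [Real.sqrt_eq_zero_of_nonpos (by linarith [hr.1]), inv_zero]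

theorem integral_inv_sqrt_sub {s t : ℝ} (hst : s ≤ t) :
    ∫ r in s..t, (√(t - r))⁻¹ = 2 * √(t - s) := by
  rw [intervalIntegral.integral_comp_sub_left (fun r => (√r)⁻¹) t, sub_self,
    intervalIntegral.integral_congr (g := fun r => r ^ (-(1 / 2) : ℝ)),
    integral_rpow (Or.inl (by norm_num)), Real.sqrt_eq_rpow,
    show (-(1 / 2) + 1 : ℝ) = 1 / 2 by norm_num, Real.zero_rpow (by norm_num)]
  · ring
  · intro r hr
    rw [Set.uIcc_of_le (by linarith)] at hr
    change (√r)⁻¹ = r ^ (-(1 / 2) : ℝ)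
    rw [Real.sqrt_eq_rpow, Real.rpow_neg hr.1]

theorem norm_integral_le_of_inv_sqrt {f : ℝ → Hsp} {s t c : ℝ} (hst : s ≤ t)
    (h : ∀ r, s < r → r < t → ‖f r‖ ≤ c * (√(t - r))⁻¹) :
    ‖∫ r in s..t, f r‖ ≤ c * (2 * √(t - s)) := by
  rw [← integral_inv_sqrt_sub hst, ← intervalIntegral.integral_const_mul]
  refine intervalIntegral.norm_integral_le_of_norm_le hst ?_
    ((intervalIntegrable_inv_sqrt_sub s t).const_mul c)
  filter_upwards [Measure.ae_ne volume t] with r hrt hr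
  exact h r hr.1 (lt_of_le_of_ne hr.2 hrt)

/-- The integral form of Grönwall's inequality for a continuous function. -/
theorem le_mul_exp_of_le_add_integral {u : ℝ → ℝ} (hu : ContinuousOn u (Set.Ici 0)) {c K : ℝ}
    (hK : 0 ≤ K) (h : ∀ t, 0 ≤ t → u t ≤ c + K * ∫ s in (0 : ℝ)..t, u s) {t : ℝ} (ht : 0 ≤ t) :
    u t ≤ c * Real.exp (K * t) := by
  have hint (t : ℝ) (ht : 0 ≤ t) : IntervalIntegrable u volume 0 t :=
    (hu.mono fun s hs => (le_min le_rfl ht).trans hs.1).intervalIntegrable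
  have hd (x : ℝ) (hx : 0 ≤ x) :
      HasDerivWithinAt (fun t => c + K * ∫ s in (0 : ℝ)..t, u s) (K * u x) (Set.Ici x) x := by
    have hmono : Set.Ici x ⊆ Set.Ici (0 : ℝ) := Set.Ici_subset_Ici.2 hx
    refine ((intervalIntegral.integral_hasDerivWithinAt_right (hint x hx)
      (s := Set.Ici x) (t := Set.Ioi x) ?_ ?_).const_mul K).const_add c
    · exact ((hu.mono (Set.Ioi_subset_Ici hx)).stronglyMeasurableAtFilter_nhdsWithin
        measurableSet_Ioi x)
    · exact (hu x hx).mono (Set.Ioi_subset_Ici hx)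
  have hcont : ContinuousOn (fun t => c + K * ∫ s in (0 : ℝ)..t, u s) (Set.Icc 0 t) := by
    rw [← Set.uIcc_of_le ht]
    refine ((intervalIntegral.continuousOn_primitive_interval (μ := volume) ?_).const_mul K).const_add c
    exact (hu.mono fun s hs => (le_min le_rfl ht).trans hs.1).integrableOn_compact isCompact_uIcc
  have hG := le_gronwallBound_of_liminf_deriv_right_le (f' := fun x => K * u x) (δ := c) (K := K)
    (ε := 0) hcont (fun x hx r hr => (hd x hx.1).liminf_right_slope_le hr) (by simp)
    (fun x hx => by
      rw [add_zero]
      exact mul_le_mul_of_nonneg_left (h x hx.1) hK) t ⟨ht, le_rfl⟩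
  rw [gronwallBound_ε0, sub_zero] at hG
  exact (h t ht).trans hG

section Mild

variable {lam : ℕ → ℝ} (hl : ∀ k, 0 ≤ lam k) {Y f : ℝ → Hsp} {y : Hsp}
  (hf : ContinuousOn f (Set.Ici 0))
  (hY : ∀ t, 0 ≤ t → Y t = heat hl t y + ∫ s in (0 : ℝ)..t, heat hl (t - s) (f s))

include hf hY

theorem mild_restart {s t : ℝ} (hs : 0 ≤ s) (hst : s ≤ t) :
    Y t = heat hl (t - s) (Y s) + ∫ r in s..t, heat hl (t - r) (f r) := by
  have ht := hs.trans hst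
  rw [hY t ht, hY s hs, map_add, ← heat_add hl (by linarith) hs, sub_add_cancel,
    ← ContinuousLinearMap.intervalIntegral_comp_comm _
      (intervalIntegrable_heat hl hf s le_rfl hs), add_assoc,
    ← intervalIntegral.integral_add_adjacent_intervals
      (intervalIntegrable_heat hl hf t le_rfl hs) (intervalIntegrable_heat hl hf t hs ht)]
  congr 2
  refine intervalIntegral.integral_congr fun r hr => ?_
  rw [Set.uIcc_of_le hs] at hr
  change heat hl (t - r) (f r) = heat hl (t - s) (heat hl (s - r) (f r))
  rw [← heat_add hl (by linarith) (by linarith [hr.2])]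
  congr 2
  ring

variable {T B : ℝ} (hB : ∀ s ∈ Set.Icc 0 T, ‖f s‖ ≤ B)

include hB

theorem memD_and_nrmD_half_mild_le {s : ℝ} (hs : 0 < s) (hsT : s ≤ T) :
    memD lam (1 / 2) (Y s) ∧
      nrmD lam (1 / 2) (Y s) ≤ (√s)⁻¹ * (‖y‖ + 2 * B * T) := by
  have hB0 : 0 ≤ B := (norm_nonneg _).trans (hB s ⟨hs.le, hsT⟩)
  have hsm (n : ℕ) {r : ℝ} (hr : 0 < r) (v : Hsp) :
      ‖truncPow hl (1 / 2) n (heat hl r v)‖ ≤ (√r)⁻¹ * ‖v‖ := by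
    have := norm_truncPow_heat_le hl (σ := 1 / 2) (by norm_num) (by norm_num) n hr v
    rwa [Real.rpow_neg hr.le, ← Real.sqrt_eq_rpow] at this
  refine memD_and_nrmD_le_of_truncPow hl fun n => ?_
  rw [hY s hs.le, map_add, ← ContinuousLinearMap.intervalIntegral_comp_comm _
      (intervalIntegrable_heat hl hf s le_rfl hs.le)]
  have h2 : ‖∫ r in (0 : ℝ)..s, truncPow hl (1 / 2) n (heat hl (s - r) (f r))‖ ≤
      B * (2 * √(s - 0)) := by
    refine norm_integral_le_of_inv_sqrt hs.le fun r hr hrs => ?_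
    refine (hsm n (sub_pos.2 hrs) _).trans ?_
    rw [mul_comm]
    gcongr
    exact hB r ⟨hr.le, by linarith⟩
  have h3 : √s ≤ (√s)⁻¹ * T := by
    rw [← div_eq_inv_mul, le_div_iff₀ (Real.sqrt_pos.2 hs), Real.mul_self_sqrt hs.le]
    exact hsT
  rw [sub_zero] at h2
  calc _ ≤ (√s)⁻¹ * ‖y‖ + B * (2 * √s) := (norm_add_le _ _).trans (add_le_add (hsm n hs y) h2)
    _ ≤ (√s)⁻¹ * ‖y‖ + B * (2 * ((√s)⁻¹ * T)) := by gcongr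
    _ = _ := by ring

theorem norm_mild_sub_le {s t : ℝ} (hs : 0 < s) (hst : s ≤ t) (htT : t ≤ T) :
    ‖Y t - Y s‖ ≤ √(t - s) * (√s)⁻¹ * (‖y‖ + 3 * B * T) := by
  have hB0 : 0 ≤ B := (norm_nonneg _).trans (hB s ⟨hs.le, by linarith⟩)
  have hT : 0 ≤ T := by linarith
  obtain ⟨hm, hn⟩ := memD_and_nrmD_half_mild_le hl hf hY hB hs (hst.trans htT)
  have h1 := (norm_heat_sub_le hl (sub_nonneg.2 hst) hm).trans
    (mul_le_mul_of_nonneg_left hn (Real.sqrt_nonneg _))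
  have h2 : ‖∫ r in s..t, heat hl (t - r) (f r)‖ ≤ B * |t - s| := by
    refine intervalIntegral.norm_integral_le_of_norm_le_const fun r hr => ?_
    rw [Set.uIoc_of_le hst] at hr
    exact (norm_heat_apply_le hl _ _).trans (hB r ⟨by linarith [hr.1], hr.2.trans htT⟩)
  have h3 : |t - s| ≤ √(t - s) * ((√s)⁻¹ * T) := by
    rw [abs_of_nonneg (by linarith)]
    calc t - s = √(t - s) * √(t - s) := (Real.mul_self_sqrt (by linarith)).symm
      _ ≤ √(t - s) * ((√s)⁻¹ * T) := by
        gcongr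
        rw [← div_eq_inv_mul, le_div_iff₀ (Real.sqrt_pos.2 hs), ← Real.sqrt_mul (by linarith)]
        refine Real.sqrt_le_iff.2 ⟨hT, ?_⟩
        nlinarith
  rw [mild_restart hl hf hY hs.le hst, add_sub_right_comm]
  calc _ ≤ √(t - s) * ((√s)⁻¹ * (‖y‖ + 2 * B * T)) + B * (√(t - s) * ((√s)⁻¹ * T)) :=
        (norm_add_le _ _).trans (add_le_add h1 (h2.trans (by gcongr)))
    _ = _ := by ring

/-- The `D(A)` bound for a mild solution whose forcing term is Hölder continuous near `t`. -/
theorem memD_and_nrmD_one_mild_le {t c E : ℝ} (ht : 0 < t) (htT : t ≤ T)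
    (hE : ‖Y (t / 2)‖ ≤ E) (hc : 0 ≤ c)
    (hH : ∀ s, t / 2 < s → s < t → ‖f s - f t‖ ≤ c * √(t - s)) :
    memD lam 1 (Y t) ∧ nrmD lam 1 (Y t) ≤ 2 * t⁻¹ * E + c * (2 * √T) + B := by
  have ht2 : 0 ≤ t / 2 := by positivity
  have ht2' : t / 2 ≤ t := by linarith
  have hsm (n : ℕ) {r : ℝ} (hr : 0 < r) (v : Hsp) :
      ‖truncPow hl 1 n (heat hl r v)‖ ≤ r⁻¹ * ‖v‖ := by
    simpa [Real.rpow_neg_one] using norm_truncPow_heat_le hl zero_le_one le_rfl n hr v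
  refine memD_and_nrmD_le_of_truncPow hl fun n => ?_
  have hi1 := intervalIntegrable_heat hl (f := fun s => f s - f t)
    (hf.sub continuousOn_const) t ht2 ht.le
  have hi2 := intervalIntegrable_heat hl (f := fun _ => f t) continuousOn_const t ht2 ht.le
  have hsplit : ∫ r in t / 2..t, heat hl (t - r) (f r) =
      (∫ r in t / 2..t, heat hl (t - r) (f r - f t)) + ∫ r in t / 2..t, heat hl (t - r) (f t) := by
    rw [← intervalIntegral.integral_add hi1 hi2]
    simp
  have h1 : ‖truncPow hl 1 n (heat hl (t - t / 2) (Y (t / 2)))‖ ≤ 2 * t⁻¹ * E := by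
    refine (hsm n (by linarith) _).trans ?_
    rw [show (t - t / 2)⁻¹ = 2 * t⁻¹ by field_simp; norm_num]
    gcongr
  have h2 : ‖truncPow hl 1 n (∫ r in t / 2..t, heat hl (t - r) (f r - f t))‖ ≤
      c * (2 * √T) := by
    rw [← ContinuousLinearMap.intervalIntegral_comp_comm _ hi1]
    refine (norm_integral_le_of_inv_sqrt (c := c) ht2' fun r hr hrt => ?_).trans ?_
    · have hp : 0 < t - r := sub_pos.2 hrt
      refine (hsm n hp _).trans ((mul_le_mul_of_nonneg_left (hH r hr hrt)
        (inv_nonneg.2 hp.le)).trans_eq ?_)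
      have hq := Real.sqrt_pos.2 hp
      nth_rewrite 1 [← Real.mul_self_sqrt hp.le]
      field_simp
    · gcongr
      linarith
  have h3 := (norm_truncPow_integral_heat_le hl n ht2 ht2' (f t)).trans (hB t ⟨ht.le, htT⟩)
  rw [mild_restart hl hf hY ht2 ht2', hsplit, map_add, map_add, ← add_assoc]
  exact (norm_add₃_le).trans (add_le_add (add_le_add h1 h2) h3)

end Mild

/-- Proposition B.6: the bound `|A η(t)| ≤ C (1 + t^{-1}) (1 + ‖x‖) ‖h‖` for the first
variation `η` of the averaged flow, where `X̄` is the mild solution of the averaged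
equation with bounded Lipschitz `F̄`, `η(t) = S(t)h + ∫₀ᵗ S(t−s) 𝓛(X̄(s))(η(s)) ds`,
`‖𝓛(z)‖ ≤ K` and `‖(𝓛(z₁)−𝓛(z₂))k‖ ≤ K ‖z₁−z₂‖ |k|_a` for `k ∈ D_a`, `a ∈ (0,1/2)`. -/
theorem stmt14
    (lam : ℕ → ℝ) (lam0 : ℝ) (hlam0 : 0 < lam0) (hlam : ∀ k, lam0 ≤ lam k)
    (S : ℝ → Hsp → Hsp)
    (hS : ∀ t : ℝ, 0 ≤ t → ∀ (x : Hsp) (k : ℕ), S t x k = Real.exp (-(lam k * t)) * x k)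
    (M L K : ℝ) (hM : 0 ≤ M) (hL : 0 ≤ L) (hK : 0 ≤ K)
    (a : ℝ) (ha : a ∈ Set.Ioo (0:ℝ) (1/2))
    (T : ℝ) (hT : 0 < T) :
    ∃ C > 0, ∀ Fbar : Hsp → Hsp,
      (∀ z : Hsp, ‖Fbar z‖ ≤ M) →
      (∀ z₁ z₂ : Hsp, ‖Fbar z₁ - Fbar z₂‖ ≤ L * ‖z₁ - z₂‖) →
      ∀ 𝓛 : Hsp → Hsp →L[ℝ] Hsp,
      (∀ z : Hsp, ‖𝓛 z‖ ≤ K) →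
      (∀ z₁ z₂ k : Hsp, memD lam a k →
        ‖(𝓛 z₁ - 𝓛 z₂) k‖ ≤ K * ‖z₁ - z₂‖ * nrmD lam a k) →
      ∀ x h : Hsp, ∀ X : ℝ → Hsp, ContinuousOn X (Set.Ici 0) →
      (∀ t : ℝ, 0 ≤ t → X t = S t x + ∫ s in (0:ℝ)..t, S (t - s) (Fbar (X s))) →
      ∀ η : ℝ → Hsp, ContinuousOn η (Set.Ici 0) →
      ContinuousOn (fun s => 𝓛 (X s) (η s)) (Set.Ici 0) →
      (∀ t : ℝ, 0 ≤ t → η t = S t h + ∫ s in (0:ℝ)..t, S (t - s) (𝓛 (X s) (η s))) →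
      ∀ t ∈ Set.Ioc (0:ℝ) T,
        memD lam 1 (η t) ∧
        nrmD lam 1 (η t) ≤ C * (1 + t⁻¹) * (1 + ‖x‖) * ‖h‖ := by
  have hl : ∀ k, 0 ≤ lam k := fun k => hlam0.le.trans (hlam k)
  set E := Real.exp (K * T) with hE
  have hE0 : 0 < E := Real.exp_pos _
  set c₁ := 1 + 3 * M * T with hc₁
  set c₂ := 1 + 3 * (K * E) * T with hc₂
  have hc₁0 : 0 ≤ c₁ := by positivity
  have hc₂0 : 0 ≤ c₂ := by positivity
  have hla : 0 < lam0 ^ (a - 1 / 2) := Real.rpow_pos_of_pos hlam0 _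
  set D := K * c₂ + K * c₁ * (lam0 ^ (a - 1 / 2) * c₂) with hD
  have hD0 : 0 ≤ D := by positivity
  refine ⟨2 * E + 8 * √T * D + K * E, by positivity, ?_⟩
  intro Fbar hFM hFL 𝓛 hLK hLa x h X hXc hX η hηc hgc hη t ht
  have hSh (t : ℝ) (ht : 0 ≤ t) (v : Hsp) : S t v = heat hl t v := by
    ext k
    rw [hS t ht, heat_apply hl ht]
  have hSi (f : ℝ → Hsp) (t : ℝ) (ht : 0 ≤ t) :
      ∫ s in (0 : ℝ)..t, S (t - s) (f s) = ∫ s in (0 : ℝ)..t, heat hl (t - s) (f s) := by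
    refine intervalIntegral.integral_congr fun s hs => ?_
    rw [Set.uIcc_of_le ht] at hs
    exact hSh _ (by linarith [hs.2]) _
  have hX' (t : ℝ) (ht : 0 ≤ t) :
      X t = heat hl t x + ∫ s in (0 : ℝ)..t, heat hl (t - s) (Fbar (X s)) := by
    rw [hX t ht, hSh t ht, hSi (fun s => Fbar (X s)) t ht]
  have hη' (t : ℝ) (ht : 0 ≤ t) :
      η t = heat hl t h + ∫ s in (0 : ℝ)..t, heat hl (t - s) (𝓛 (X s) (η s)) := by
    rw [hη t ht, hSh t ht, hSi (fun s => 𝓛 (X s) (η s)) t ht]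
  have hFc : ContinuousOn (fun s => Fbar (X s)) (Set.Ici 0) := by
    have hlip : LipschitzWith L.toNNReal Fbar := LipschitzWith.of_dist_le' fun u v => by
      simpa [dist_eq_norm] using hFL u v
    exact hlip.continuous.comp_continuousOn hXc
  have hLη (z v : Hsp) : ‖𝓛 z v‖ ≤ K * ‖v‖ := (𝓛 z).le_of_opNorm_le (hLK z) v
  have hηE (s : ℝ) (hs : s ∈ Set.Icc 0 T) : ‖η s‖ ≤ E * ‖h‖ := by
    have hgr (r : ℝ) (hr : 0 ≤ r) : ‖η r‖ ≤ ‖h‖ + K * ∫ s in (0 : ℝ)..r, ‖η s‖ := by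
      have hi : IntervalIntegrable (fun s => K * ‖η s‖) volume 0 r :=
        ((hηc.norm.const_mul K).mono
          fun s hs => (le_min le_rfl hr).trans hs.1).intervalIntegrable
      rw [hη' r hr, ← intervalIntegral.integral_const_mul]
      refine (norm_add_le _ _).trans (add_le_add (norm_heat_apply_le hl _ _) ?_)
      exact intervalIntegral.norm_integral_le_of_norm_le hr
        (ae_of_all _ fun s _ => (norm_heat_apply_le hl _ _).trans (hLη _ _)) hi
    refine (le_mul_exp_of_le_add_integral hηc.norm hK hgr hs.1).trans ?_
    rw [mul_comm, hE]
    gcongr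
    exact hs.2
  have hgB (s : ℝ) (hs : s ∈ Set.Icc 0 T) : ‖𝓛 (X s) (η s)‖ ≤ K * (E * ‖h‖) :=
    (hLη _ _).trans (mul_le_mul_of_nonneg_left (hηE s hs) hK)
  have ht2 : 0 < t / 2 := half_pos ht.1
  have hH (s : ℝ) (hs : t / 2 < s) (hst : s < t) :
      ‖𝓛 (X s) (η s) - 𝓛 (X t) (η t)‖ ≤
        D * (1 + ‖x‖) * ‖h‖ * (4 * (1 + t⁻¹)) * √(t - s) := by
    have hs0 : 0 < s := ht2.trans hs
    have hXs := norm_mild_sub_le hl hFc hX' (T := T) (fun s _ => hFM (X s)) hs0 hst.le ht.2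
    have hηs := norm_mild_sub_le hl hgc hη' hgB hs0 hst.le ht.2
    obtain ⟨hm, hn⟩ := memD_and_nrmD_half_mild_le hl hgc hη' hgB hs0 (hst.le.trans ht.2)
    obtain ⟨hma, hna⟩ := memD_and_nrmD_le_of_le hlam0 hlam ha.2.le hm
    have hq : 0 < (√s)⁻¹ := inv_pos.2 (Real.sqrt_pos.2 hs0)
    have hqq : (√s)⁻¹ * (√s)⁻¹ = s⁻¹ := by rw [← mul_inv, Real.mul_self_sqrt hs0.le]
    have hsi : s⁻¹ ≤ 2 * t⁻¹ := by
      rw [← div_eq_mul_inv, inv_eq_one_div, div_le_div_iff₀ hs0 ht.1]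
      linarith
    have hti : 0 < t⁻¹ := inv_pos.2 ht.1
    have hq1 : (√s)⁻¹ ≤ 4 * (1 + t⁻¹) := by nlinarith [sq_nonneg ((√s)⁻¹ - 1)]
    have hq2 : (√s)⁻¹ * (√s)⁻¹ ≤ 4 * (1 + t⁻¹) := by linarith
    have hx1 : ‖x‖ + 3 * M * T ≤ c₁ * (1 + ‖x‖) := by
      have : 0 ≤ 3 * M * T * ‖x‖ := by positivity
      rw [hc₁]
      linarith
    have hh1 : ‖h‖ + 3 * (K * (E * ‖h‖)) * T = c₂ * ‖h‖ := by rw [hc₂]; ring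
    have hh2 : ‖h‖ + 2 * (K * (E * ‖h‖)) * T ≤ c₂ * ‖h‖ := by
      have : 0 ≤ K * (E * ‖h‖) * T := by positivity
      rw [← hh1]
      linarith
    have hsplit : 𝓛 (X t) (η t) - 𝓛 (X s) (η s) =
        𝓛 (X t) (η t - η s) + (𝓛 (X t) - 𝓛 (X s)) (η s) := by
      rw [map_sub, sub_apply]
      abel
    rw [norm_sub_rev, hsplit]
    have hr := Real.sqrt_nonneg (t - s)
    have h1x : 1 ≤ 1 + ‖x‖ := by linarith [norm_nonneg x]
    calc ‖𝓛 (X t) (η t - η s) + (𝓛 (X t) - 𝓛 (X s)) (η s)‖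
        ≤ K * ‖η t - η s‖ + K * ‖X t - X s‖ * nrmD lam a (η s) :=
          (norm_add_le _ _).trans (add_le_add (hLη _ _) (hLa _ _ _ hma))
      _ ≤ K * (√(t - s) * (√s)⁻¹ * (c₂ * ‖h‖)) +
          K * (√(t - s) * (√s)⁻¹ * (c₁ * (1 + ‖x‖))) *
            (lam0 ^ (a - 1 / 2) * ((√s)⁻¹ * (c₂ * ‖h‖))) := by
          have e1 : ‖η t - η s‖ ≤ √(t - s) * (√s)⁻¹ * (c₂ * ‖h‖) := hh1 ▸ hηs
          have e2 : ‖X t - X s‖ ≤ √(t - s) * (√s)⁻¹ * (c₁ * (1 + ‖x‖)) :=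
            hXs.trans (by gcongr)
          have e3 : nrmD lam a (η s) ≤ lam0 ^ (a - 1 / 2) * ((√s)⁻¹ * (c₂ * ‖h‖)) :=
            hna.trans (mul_le_mul_of_nonneg_left (hn.trans (by gcongr)) hla.le)
          have e4 : 0 ≤ nrmD lam a (η s) := Real.sqrt_nonneg _
          gcongr
      _ = K * c₂ * ‖h‖ * √(t - s) * (√s)⁻¹ * 1 + K * c₁ * (lam0 ^ (a - 1 / 2) * c₂) *
            ‖h‖ * √(t - s) * ((√s)⁻¹ * (√s)⁻¹) * (1 + ‖x‖) := by ring
      _ ≤ K * c₂ * ‖h‖ * √(t - s) * (4 * (1 + t⁻¹)) * (1 + ‖x‖) +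
          K * c₁ * (lam0 ^ (a - 1 / 2) * c₂) *
            ‖h‖ * √(t - s) * (4 * (1 + t⁻¹)) * (1 + ‖x‖) := by gcongr
      _ = D * (1 + ‖x‖) * ‖h‖ * (4 * (1 + t⁻¹)) * √(t - s) := by rw [hD]; ring
  have hti : 0 < t⁻¹ := inv_pos.2 ht.1
  obtain ⟨hm, hn⟩ := memD_and_nrmD_one_mild_le hl hgc hη' hgB ht.1 ht.2
    (hηE (t / 2) ⟨ht2.le, by linarith [ht.1, ht.2]⟩) (by positivity) hH
  refine ⟨hm, hn.trans ?_⟩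
  have hx0 := norm_nonneg x
  have hA : t⁻¹ ≤ (1 + t⁻¹) * (1 + ‖x‖) := by nlinarith
  have hB : 1 ≤ (1 + t⁻¹) * (1 + ‖x‖) := by nlinarith
  calc 2 * t⁻¹ * (E * ‖h‖) + D * (1 + ‖x‖) * ‖h‖ * (4 * (1 + t⁻¹)) * (2 * √T) + K * (E * ‖h‖)
      = 2 * E * ‖h‖ * t⁻¹ + 8 * √T * D * ‖h‖ * ((1 + t⁻¹) * (1 + ‖x‖)) + K * E * ‖h‖ * 1 := by
        ring
    _ ≤ 2 * E * ‖h‖ * ((1 + t⁻¹) * (1 + ‖x‖)) + 8 * √T * D * ‖h‖ * ((1 + t⁻¹) * (1 + ‖x‖)) +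
          K * E * ‖h‖ * ((1 + t⁻¹) * (1 + ‖x‖)) := by gcongr
    _ = _ := by ring

end
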